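/- arXiv:1902.01801 — 2 statements merged into one kernel-verified Lean document; each statement's English description precedes it below -/
import Mathlib

section
/- Let m, n be positive integers, X a real n×m matrix, Z a real m×n matrix, and s, t ∈ ℝ such that both Iₘ + sZX and Iₘ + (s+t)ZX are invertible. Then Iₘ + tZ·φ_s(X) is invertible and φ_t(φ_s(X)) = φ_{s+t}(X), where φ_u(X) := X·(Iₘ + uZX)⁻¹. -/
open Matrix

/-- The local flow `φ_u(X) = X (Iₘ + uZX)⁻¹` on the affine chart of the Grassmannian. -/
noncomputable def grFlow {m n : ℕ} (Z : Matrix (Fin m) (Fin n) ℝ) (u : ℝ)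
    (X : Matrix (Fin n) (Fin m) ℝ) : Matrix (Fin n) (Fin m) ℝ :=
  X * ((1 : Matrix (Fin m) (Fin m) ℝ) + u • (Z * X))⁻¹

/-- The cocycle identity `Iₘ + tZ φ_s(X) = (Iₘ + (s+t)ZX) (Iₘ + sZX)⁻¹`. -/
theorem one_add_smul_mul_grFlow {m n : ℕ}
    (X : Matrix (Fin n) (Fin m) ℝ) (Z : Matrix (Fin m) (Fin n) ℝ) (s t : ℝ)
    (hs : IsUnit ((1 : Matrix (Fin m) (Fin m) ℝ) + s • (Z * X))) :
    (1 : Matrix (Fin m) (Fin m) ℝ) + t • (Z * grFlow Z s X) =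
      (1 + (s + t) • (Z * X)) * (1 + s • (Z * X))⁻¹ := by
  have hdet := (Matrix.isUnit_iff_isUnit_det _).mp hs
  rw [add_smul, ← add_assoc, add_mul _ (t • (Z * X)), Matrix.mul_nonsing_inv _ hdet, grFlow,
    Matrix.smul_mul, Matrix.mul_assoc]

/-- the local one-parameter flow law `φ_t ∘ φ_s = φ_{s+t}`. -/
theorem stmt2 (m n : ℕ) (hm : 0 < m) (hn : 0 < n)
    (X : Matrix (Fin n) (Fin m) ℝ) (Z : Matrix (Fin m) (Fin n) ℝ) (s t : ℝ)
    (hs : IsUnit ((1 : Matrix (Fin m) (Fin m) ℝ) + s • (Z * X)))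
    (hst : IsUnit ((1 : Matrix (Fin m) (Fin m) ℝ) + (s + t) • (Z * X))) :
    IsUnit ((1 : Matrix (Fin m) (Fin m) ℝ) + t • (Z * grFlow Z s X)) ∧
      grFlow Z t (grFlow Z s X) = grFlow Z (s + t) X := by
  have hdet := (Matrix.isUnit_iff_isUnit_det _).mp hs
  have key := one_add_smul_mul_grFlow X Z s t hs
  refine ⟨?_, ?_⟩
  · rw [key]
    exact hst.mul (Matrix.isUnit_nonsing_inv_iff.mpr hs)
  · rw [grFlow, key, Matrix.mul_inv_rev, Matrix.nonsing_inv_nonsing_inv _ hdet, grFlow, grFlow,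
      Matrix.mul_assoc, Matrix.nonsing_inv_mul_cancel_left _ _ hdet]
end

section
/- Let m, n be positive integers, Z a real m×n matrix of rank at most 1, and X a real n×m matrix. Then X·Z·X = 0 if and only if Z·X = 0 or X·Z = 0. -/
open Matrix

/-- A matrix of rank at most one is an outer product of two vectors. -/
theorem Matrix.exists_eq_vecMulVec_of_rank_le_one {m n K : Type*} [Fintype m] [Fintype n]
    [Field K] {A : Matrix m n K} (hA : A.rank ≤ 1) :
    ∃ (u : m → K) (v : n → K), A = vecMulVec u v := by
  classical
  obtain ⟨u, hu⟩ := finrank_le_one_iff.mp hA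
  choose c hc using fun j => hu ⟨A.mulVecLin (Pi.single j 1), LinearMap.mem_range_self _ _⟩
  refine ⟨u, c, ?_⟩
  ext i j
  have h := congrFun (congrArg Subtype.val (hc j)) i
  simpa [vecMulVec_apply, mul_comm, eq_comm] using h

/-- for `Z` of rank at most one, `XZX = 0` iff `ZX = 0` or `XZ = 0`.
This characterizes the fixed points of the strongly essential flow `z^t = I + tZ`. -/
theorem stmt3 (m n : ℕ) (hm : 0 < m) (hn : 0 < n)
    (Z : Matrix (Fin m) (Fin n) ℝ) (hZ : Z.rank ≤ 1)
    (X : Matrix (Fin n) (Fin m) ℝ) :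
    X * Z * X = 0 ↔ Z * X = 0 ∨ X * Z = 0 := by
  obtain ⟨u, v, rfl⟩ := Matrix.exists_eq_vecMulVec_of_rank_le_one hZ
  constructor
  · intro h
    rw [mul_vecMulVec, vecMulVec_mul] at h
    rw [vecMulVec_mul, mul_vecMulVec, vecMulVec_eq_zero, vecMulVec_eq_zero]
    by_contra! hne
    obtain ⟨i, hi⟩ := Function.ne_iff.mp hne.2.1
    obtain ⟨j, hj⟩ := Function.ne_iff.mp hne.1.2
    exact mul_ne_zero hi hj (congrFun (congrFun h i) j)
  · rintro (h | h)
    · rw [Matrix.mul_assoc, h, Matrix.mul_zero]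
    · rw [h, Matrix.zero_mul]
end
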